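/- Let k ≥ 1 be an integer and α, λ > 0. For every t > 0, the crossing probability of a Gamma-distributed boundary by the elastic Brownian motion satisfies ψ^el_{k,α}(t) = 1 − (λ√t/√2)^k · Σ_{l=0}^∞ (−α√t/√2)^l · E^k_{1/2, (l+k)/2 + 1}(−λ√t/√2). -/

import Mathlib

open Real MeasureTheory Set

/-- Mittag-Leffler function `E_{a,b}(z) = Σ z^r / Γ(a r + b)`. -/
noncomputable def mittagLeffler (a b z : ℝ) : ℝ :=
  ∑' r : ℕ, z ^ r / Real.Gamma (a * r + b)

/-- Wright function `W_{a,b}(x) = Σ x^j / (j! Γ(a j + b))`. -/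
noncomputable def wright (a b x : ℝ) : ℝ :=
  ∑' j : ℕ, x ^ j / ((Nat.factorial j : ℝ) * Real.Gamma (a * j + b))

/-- Generalized Mittag-Leffler function `E^γ_{a,b}(z) = Σ (γ)_j z^j / (j! Γ(a j + b))`. -/
noncomputable def gml (a b γ z : ℝ) : ℝ :=
  ∑' j : ℕ, (∏ i ∈ Finset.range j, (γ + i)) * z ^ j /
    ((Nat.factorial j : ℝ) * Real.Gamma (a * j + b))

/-- Caputo fractional derivative of order `ν`. -/
noncomputable def caputo (ν : ℝ) (f : ℝ → ℝ) (t : ℝ) : ℝ :=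
  (1 / Real.Gamma (1 - ν)) * ∫ s in (0:ℝ)..t, (t - s) ^ (-ν) * deriv f s
/-- Cumulative distribution function of a Gamma random variable with rate `lam`
and integer shape `k`. -/
noncomputable def gammaCdf (lam : ℝ) (k : ℕ) (y : ℝ) : ℝ :=
  (lam ^ k / Real.Gamma k) * ∫ z in (0:ℝ)..y, Real.exp (-lam * z) * z ^ (k - 1)
/-- Crossing probability of a Gamma(`lam`,`k`) boundary by the elastic Brownian
motion with absorbing rate `α`. -/
noncomputable def psiElGamma (k : ℕ) (α lam t : ℝ) : ℝ :=
  2 * (∫ s in Set.Ioi (0:ℝ), (1 - gammaCdf lam k s) * Real.exp (α * s) *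
      ∫ w in Set.Ioi s, w * Real.exp (-α * w) * Real.exp (-(w ^ 2) / (2 * t)) /
        Real.sqrt (2 * Real.pi * t ^ 3)) +
    1 - 2 * Real.exp (α ^ 2 * t / 2) *
      ∫ w in Set.Ioi (α * Real.sqrt t), Real.exp (-(w ^ 2) / 2) / Real.sqrt (2 * Real.pi)

/-- First-passage kernel `w e^{-w²/(2t)} / √(2πt³)` of Brownian motion. -/
noncomputable def passageKernel (t w : ℝ) : ℝ :=
  w * Real.exp (-(w ^ 2) / (2 * t)) / Real.sqrt (2 * Real.pi * t ^ 3)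

lemma passageKernel_nonneg {t w : ℝ} (hw : 0 ≤ w) : 0 ≤ passageKernel t w := by
  unfold passageKernel; positivity

lemma continuous_passageKernel (t : ℝ) : Continuous (passageKernel t) := by
  unfold passageKernel; fun_prop

lemma integrableOn_pow_mul_exp_mul_gaussian {t : ℝ} (ht : 0 < t) (c : ℝ) (m : ℕ) :
    IntegrableOn (fun w : ℝ => w ^ m * Real.exp (c * w) * Real.exp (-(w ^ 2) / (2 * t)))
      (Ioi 0) := by
  have h := (integrableOn_rpow_mul_exp_neg_mul_sq (b := 1 / (4 * t)) (by positivity)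
    (s := (m : ℝ)) (by linarith [(Nat.cast_nonneg m : (0 : ℝ) ≤ m)])).const_mul
      (Real.exp (c ^ 2 * t))
  refine Integrable.mono' h (by fun_prop) ?_
  refine (ae_restrict_iff' measurableSet_Ioi).2 (Filter.Eventually.of_forall fun w hw => ?_)
  have hw : 0 < w := hw
  rw [Real.norm_of_nonneg (by positivity), Real.rpow_natCast, mul_assoc, ← Real.exp_add,
    mul_left_comm, ← Real.exp_add]
  refine mul_le_mul_of_nonneg_left (Real.exp_le_exp.2 ?_) (by positivity)
  have key : c ^ 2 * t + -(1 / (4 * t)) * w ^ 2 - (c * w + -w ^ 2 / (2 * t))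
      = (w - 2 * c * t) ^ 2 / (4 * t) := by field_simp; ring
  have : 0 ≤ (w - 2 * c * t) ^ 2 / (4 * t) := by positivity
  linarith

lemma integrableOn_pow_mul_exp_mul_passageKernel {t : ℝ} (ht : 0 < t) (c : ℝ) (m : ℕ) :
    IntegrableOn (fun w : ℝ => w ^ m * Real.exp (c * w) * passageKernel t w) (Ioi 0) := by
  have h := (integrableOn_pow_mul_exp_mul_gaussian ht c (m + 1)).div_const
    (Real.sqrt (2 * Real.pi * t ^ 3))
  refine h.congr (Filter.Eventually.of_forall fun w => ?_)
  simp only [passageKernel]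
  ring

lemma integral_pow_mul_passageKernel {t : ℝ} (ht : 0 < t) (n : ℕ) :
    ∫ w in Ioi (0 : ℝ), w ^ (n + 1) * passageKernel t w =
      (n + 1).factorial / (2 * Real.Gamma ((n : ℝ) / 2 + 1)) *
        (Real.sqrt t / Real.sqrt 2) ^ n := by
  have h := integral_rpow_mul_exp_neg_mul_rpow (p := 2) (q := (n : ℝ) + 2) (b := 1 / (2 * t))
    two_pos (by linarith [(Nat.cast_nonneg n : (0 : ℝ) ≤ n)]) (by positivity)
  have h1 : ∫ w in Ioi (0 : ℝ), w ^ (n + 1) * passageKernel t w =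
      (∫ w in Ioi (0 : ℝ), w ^ ((n : ℝ) + 2) * Real.exp (-(1 / (2 * t)) * w ^ (2 : ℝ))) /
        Real.sqrt (2 * Real.pi * t ^ 3) := by
    rw [← integral_div]
    refine setIntegral_congr_fun measurableSet_Ioi fun w _ => ?_
    have e1 : w ^ ((n : ℝ) + 2) = w ^ (n + 2) := by exact_mod_cast Real.rpow_natCast w (n + 2)
    have e2 : w ^ (2 : ℝ) = w ^ 2 := by exact_mod_cast Real.rpow_natCast w 2
    simp only [passageKernel, e1, e2]
    rw [show -(1 / (2 * t)) * w ^ 2 = -(w ^ 2) / (2 * t) by ring]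
    ring
  rw [h1, h]
  have hd := Real.Gamma_mul_Gamma_add_half ((n : ℝ) / 2 + 1)
  have hf : Real.Gamma (2 * ((n : ℝ) / 2 + 1)) = (n + 1).factorial := by
    rw [← Real.Gamma_nat_eq_factorial]; push_cast; congr 1; ring
  rw [hf, show (n : ℝ) / 2 + 1 + 1 / 2 = ((n : ℝ) + 2 + 1) / 2 by ring] at hd
  have hG : 0 < Real.Gamma ((n : ℝ) / 2 + 1) := Real.Gamma_pos_of_pos (by positivity)
  have hΓ : Real.Gamma (((n : ℝ) + 2 + 1) / 2) = (n + 1).factorial *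
      2 ^ (1 - 2 * ((n : ℝ) / 2 + 1)) * Real.sqrt Real.pi / Real.Gamma ((n : ℝ) / 2 + 1) := by
    rw [eq_div_iff hG.ne', mul_comm, hd]
  have e2 : (2 : ℝ) ^ (1 - 2 * ((n : ℝ) / 2 + 1)) = 1 / 2 ^ (n + 1) := by
    rw [show 1 - 2 * ((n : ℝ) / 2 + 1) = -((n + 1 : ℕ) : ℝ) by push_cast; ring,
      Real.rpow_neg two_pos.le, Real.rpow_natCast, one_div]
  have e3 : (1 / (2 * t)) ^ (-((n : ℝ) + 2 + 1) / 2) = Real.sqrt (2 * t) ^ (n + 3) := by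
    rw [one_div, Real.inv_rpow (by positivity), ← Real.rpow_neg (by positivity),
      Real.sqrt_eq_rpow, ← Real.rpow_natCast, ← Real.rpow_mul (by positivity)]
    congr 1; push_cast; ring
  have e4 : Real.sqrt (2 * Real.pi * t ^ 3) =
      Real.sqrt 2 * Real.sqrt Real.pi * Real.sqrt t ^ 3 := by
    rw [Real.sqrt_mul (by positivity), Real.sqrt_mul (by positivity)]
    congr 1
    rw [Real.sqrt_eq_iff_mul_self_eq (by positivity) (by positivity)]
    nlinarith [Real.mul_self_sqrt ht.le, show (Real.sqrt t ^ 3 * Real.sqrt t ^ 3) =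
      (Real.sqrt t * Real.sqrt t) ^ 3 by ring, show t ^ 3 = (Real.sqrt t * Real.sqrt t) ^ 3 by
        rw [Real.mul_self_sqrt ht.le]]
  rw [hΓ, e2, e3, e4, Real.sqrt_mul two_pos.le]
  have s2 : (2 : ℝ) ^ (n + 1) = Real.sqrt 2 ^ (n + 1) * Real.sqrt 2 ^ (n + 1) := by
    rw [← mul_pow, Real.mul_self_sqrt two_pos.le]
  have hst : 0 < Real.sqrt t := Real.sqrt_pos.2 ht
  rw [s2, div_pow]
  field_simp
  ring

lemma integral_pow_mul_sub_pow (w : ℝ) (l : ℕ) : ∀ m : ℕ,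
    ∫ s in (0 : ℝ)..w, s ^ m * (w - s) ^ l =
      m.factorial * l.factorial / (m + l + 1).factorial * w ^ (m + l + 1) := by
  induction l with
  | zero =>
    intro m
    simp [Nat.factorial_succ]
    field_simp
  | succ l ih =>
    intro m
    have hu : ∀ s ∈ uIcc 0 w, HasDerivAt (fun s : ℝ => (w - s) ^ (l + 1))
        (-((l + 1 : ℝ) * (w - s) ^ l)) s := fun s _ => by
      have := ((hasDerivAt_id s).const_sub w).pow (l + 1)
      refine this.congr_deriv ?_
      simp
    have hv : ∀ s ∈ uIcc 0 w, HasDerivAt (fun s : ℝ => s ^ (m + 1) / (m + 1)) (s ^ m) s :=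
      fun s _ => by
        have := (hasDerivAt_pow (m + 1) s).div_const ((m : ℝ) + 1)
        refine this.congr_deriv ?_
        push_cast [Nat.add_sub_cancel]
        field_simp
    have := intervalIntegral.integral_mul_deriv_eq_deriv_mul hu hv
      (by apply Continuous.intervalIntegrable; fun_prop)
      (by apply Continuous.intervalIntegrable; fun_prop)
    simp only [mul_comm (_ ^ m) _]
    rw [this]
    have e : (fun s : ℝ => -((l + 1 : ℝ) * (w - s) ^ l) * (s ^ (m + 1) / (m + 1))) =
        fun s => (-((l + 1 : ℝ) / (m + 1))) * (s ^ (m + 1) * (w - s) ^ l) := by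
      ext s; field_simp
    rw [e, intervalIntegral.integral_const_mul, ih (m + 1),
      show m + 1 + l + 1 = m + (l + 1) + 1 by ring, Nat.factorial_succ m, Nat.factorial_succ l]
    push_cast
    simp
    field_simp

lemma prod_range_add_natCast_mul_factorial (m j : ℕ) :
    (∏ i ∈ Finset.range j, (((m + 1 : ℕ) : ℝ) + i)) * m.factorial = (m + j).factorial := by
  induction j with
  | zero => simp
  | succ j ih =>
    rw [Finset.prod_range_succ, mul_right_comm, ih, ← Nat.add_assoc, Nat.factorial_succ]
    push_cast; ring

lemma hasSum_exp_real (x : ℝ) : HasSum (fun n : ℕ => x ^ n / (n.factorial : ℝ)) (Real.exp x) := by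
  rw [Real.exp_eq_exp_ℝ]
  exact NormedSpace.expSeries_div_hasSum_exp x

lemma hasSum_gammaCdf {lam : ℝ} (hlam : 0 < lam) (m : ℕ) {s : ℝ} (hs : 0 ≤ s) :
    HasSum (fun j : ℕ => lam ^ (m + 1) * (∏ i ∈ Finset.range j, (((m + 1 : ℕ) : ℝ) + i)) *
      (-lam) ^ j / j.factorial * (s ^ (m + j + 1) / (m + j + 1).factorial))
      (gammaCdf lam (m + 1) s) := by
  have h : HasSum (fun j : ℕ => ∫ z in (0 : ℝ)..s, (-lam * z) ^ j / j.factorial * z ^ m)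
      (∫ z in (0 : ℝ)..s, Real.exp (-lam * z) * z ^ m) := by
    refine intervalIntegral.hasSum_integral_of_dominated_convergence
      (fun (j : ℕ) _ => (lam * s) ^ j / j.factorial * s ^ m)
      (fun j => by fun_prop) (fun j => ?_) ?_ (by simp) ?_
    · refine Filter.Eventually.of_forall fun z hz => ?_
      rw [uIoc_of_le hs] at hz
      have := hz.1.le
      have := hz.2
      rw [norm_mul, norm_div, norm_pow, norm_pow, norm_mul, norm_neg, Real.norm_of_nonneg hlam.le,
        Real.norm_of_nonneg hz.1.le, Real.norm_of_nonneg (by positivity)]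
      gcongr
    · exact Filter.Eventually.of_forall fun z _ =>
        (Real.summable_pow_div_factorial (lam * s)).mul_right _
    · exact Filter.Eventually.of_forall fun z _ => (hasSum_exp_real _).mul_right _
  unfold gammaCdf
  rw [Nat.add_sub_cancel]
  have h' := h.mul_left (lam ^ (m + 1) / Real.Gamma ((m + 1 : ℕ) : ℝ))
  refine (congrArg (HasSum · _) (funext fun j => ?_)).mpr h'
  have e : (fun z : ℝ => (-lam * z) ^ j / j.factorial * z ^ m) =
      fun z => (-lam) ^ j / j.factorial * z ^ (m + j) := by
    ext z; rw [mul_pow, pow_add]; ring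
  rw [e, intervalIntegral.integral_const_mul, integral_pow]
  have hΓ : Real.Gamma ((m + 1 : ℕ) : ℝ) = m.factorial := by
    push_cast; exact Real.Gamma_nat_eq_factorial m
  have hP := prod_range_add_natCast_mul_factorial m j
  rw [← eq_div_iff (by positivity)] at hP
  rw [hΓ, hP, Nat.factorial_succ]
  push_cast
  have : ((m + j).factorial : ℝ) ≠ 0 := by positivity
  simp
  field_simp

lemma prod_range_add_natCast_mul_factorial_le (m j l : ℕ) :
    (∏ i ∈ Finset.range j, (((m + 1 : ℕ) : ℝ) + i)) * l.factorial ≤ (m + j + l).factorial := by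
  have h1 : (∏ i ∈ Finset.range j, (((m + 1 : ℕ) : ℝ) + i)) ≤ (m + j).factorial := by
    rw [← prod_range_add_natCast_mul_factorial]
    exact le_mul_of_one_le_right (by positivity) (by exact_mod_cast Nat.factorial_pos m)
  calc _ ≤ ((m + j).factorial : ℝ) * l.factorial := by gcongr
    _ ≤ _ := by
      exact_mod_cast Nat.le_of_dvd (Nat.factorial_pos _)
        (Nat.factorial_mul_factorial_dvd_factorial_add (m + j) l)

/-- Coefficients of the double power series of the convolution of the Gamma distribution function
with an exponential. -/
noncomputable def convCoeff (m : ℕ) (α lam : ℝ) (n : ℕ × ℕ) : ℝ :=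
  lam ^ (m + 1) * (∏ i ∈ Finset.range n.2, (((m + 1 : ℕ) : ℝ) + i)) *
    (-lam) ^ n.2 / n.2.factorial * (-α) ^ n.1

lemma hasSum_mul_real {f g : ℕ → ℝ} {a b : ℝ} (hf : HasSum f a) (hg : HasSum g b) :
    HasSum (fun n : ℕ × ℕ => f n.1 * g n.2) (a * b) :=
  hf.mul hg (summable_mul_of_summable_norm hf.summable.norm hg.summable.norm)

lemma hasSum_gammaCdf_conv_exp {α lam : ℝ} (hα : 0 < α) (hlam : 0 < lam) (m : ℕ) {w : ℝ}
    (hw : 0 ≤ w) :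
    HasSum (fun n : ℕ × ℕ => convCoeff m α lam n *
      (w ^ (m + n.2 + n.1 + 2) / (m + n.2 + n.1 + 2).factorial))
      (∫ s in (0 : ℝ)..w, gammaCdf lam (m + 1) s * Real.exp (-α * (w - s))) := by
  have h : HasSum (fun n : ℕ × ℕ => ∫ s in (0 : ℝ)..w, (-α * (w - s)) ^ n.1 / n.1.factorial *
      (lam ^ (m + 1) * (∏ i ∈ Finset.range n.2, (((m + 1 : ℕ) : ℝ) + i)) *
      (-lam) ^ n.2 / n.2.factorial * (s ^ (m + n.2 + 1) / (m + n.2 + 1).factorial)))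
      (∫ s in (0 : ℝ)..w, Real.exp (-α * (w - s)) * gammaCdf lam (m + 1) s) := by
    refine intervalIntegral.hasSum_integral_of_dominated_convergence
      (fun (n : ℕ × ℕ) _ => (lam * w) ^ (m + 1) *
        ((α * w) ^ n.1 / n.1.factorial * ((lam * w) ^ n.2 / n.2.factorial)))
      (fun n => by fun_prop) (fun n => ?_) ?_ (by simp) ?_
    · refine Filter.Eventually.of_forall fun s hs => ?_
      rw [uIoc_of_le hw] at hs
      have hs0 := hs.1.le
      have hsw := hs.2
      have hP := prod_range_add_natCast_mul_factorial_le m n.2 1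
      rw [Nat.factorial_one, Nat.cast_one, mul_one] at hP
      have hP0 : 0 ≤ ∏ i ∈ Finset.range n.2, (((m + 1 : ℕ) : ℝ) + i) := by positivity
      set P := ∏ i ∈ Finset.range n.2, (((m + 1 : ℕ) : ℝ) + i)
      have e : ‖(-α * (w - s)) ^ n.1 / n.1.factorial * (lam ^ (m + 1) * P *
          (-lam) ^ n.2 / n.2.factorial * (s ^ (m + n.2 + 1) / (m + n.2 + 1).factorial))‖ =
          (α * (w - s)) ^ n.1 / n.1.factorial * (lam ^ (m + 1) * lam ^ n.2 / n.2.factorial *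
          s ^ (m + n.2 + 1)) * (P / (m + n.2 + 1).factorial) := by
        simp only [norm_mul, norm_div, norm_pow, norm_neg, Real.norm_of_nonneg hlam.le,
          Real.norm_of_nonneg hs0, Real.norm_of_nonneg hα.le, Real.norm_of_nonneg (sub_nonneg.2 hsw),
          Real.norm_of_nonneg hP0, RCLike.norm_natCast]
        ring
      rw [e]
      have hws := sub_nonneg.2 hsw
      calc _ ≤ (α * w) ^ n.1 / n.1.factorial * (lam ^ (m + 1) * lam ^ n.2 / n.2.factorial *
          w ^ (m + n.2 + 1)) * 1 := by
            have : P / (m + n.2 + 1).factorial ≤ 1 := div_le_one_of_le₀ hP (by positivity)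
            gcongr
            linarith
        _ = _ := by ring
    · exact Filter.Eventually.of_forall fun s _ =>
        (hasSum_mul_real (hasSum_exp_real (α * w)) (hasSum_exp_real (lam * w))).summable.mul_left _
    · refine Filter.Eventually.of_forall fun s hs => ?_
      rw [uIoc_of_le hw] at hs
      have h1 := hasSum_exp_real (-α * (w - s))
      have h2 := hasSum_gammaCdf hlam m hs.1.le
      exact hasSum_mul_real h1 h2
  simp only [mul_comm (gammaCdf _ _ _)]
  refine (congrArg (HasSum · _) (funext fun n => ?_)).mpr h
  have e : (fun s : ℝ => (-α * (w - s)) ^ n.1 / n.1.factorial *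
      (lam ^ (m + 1) * (∏ i ∈ Finset.range n.2, (((m + 1 : ℕ) : ℝ) + i)) *
      (-lam) ^ n.2 / n.2.factorial * (s ^ (m + n.2 + 1) / (m + n.2 + 1).factorial))) =
      fun s => convCoeff m α lam n / (n.1.factorial * (m + n.2 + 1).factorial) *
        (s ^ (m + n.2 + 1) * (w - s) ^ n.1) := by
    ext s; rw [mul_pow, convCoeff]; field_simp
  rw [e, intervalIntegral.integral_const_mul, integral_pow_mul_sub_pow,
    show m + n.2 + 1 + n.1 + 1 = m + n.2 + n.1 + 2 by ring]
  have : ((m + n.2 + 1).factorial : ℝ) ≠ 0 := by positivity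
  field_simp

lemma integrable_and_integral_swap {α t C : ℝ} (hα : 0 < α) (ht : 0 < t) {p : ℝ → ℝ}
    (hp : Continuous p) (hpC : ∀ s > 0, |p s| ≤ C * Real.exp s) :
    IntegrableOn (fun w => (∫ s in (0 : ℝ)..w, p s * Real.exp (-α * (w - s))) *
        passageKernel t w) (Ioi 0) ∧
      ∫ s in Ioi (0 : ℝ), p s * Real.exp (α * s) *
        (∫ w in Ioi s, w * Real.exp (-α * w) * Real.exp (-(w ^ 2) / (2 * t)) /
          Real.sqrt (2 * Real.pi * t ^ 3)) =
      ∫ w in Ioi (0 : ℝ), (∫ s in (0 : ℝ)..w, p s * Real.exp (-α * (w - s))) *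
        passageKernel t w := by
  set f : ℝ × ℝ → ℝ := {x : ℝ × ℝ | x.1 < x.2}.indicator
    (fun x => p x.1 * Real.exp (-α * (x.2 - x.1)) * passageKernel t x.2) with hf
  have hmeas : MeasurableSet {x : ℝ × ℝ | x.1 < x.2} := measurableSet_lt measurable_fst measurable_snd
  have hK := continuous_passageKernel t
  have hcont : Continuous
      (fun x : ℝ × ℝ => p x.1 * Real.exp (-α * (x.2 - x.1)) * passageKernel t x.2) := by fun_prop
  have hint : Integrable f ((volume.restrict (Ioi 0)).prod (volume.restrict (Ioi 0))) := by
    have h1 : Integrable (fun s : ℝ => Real.exp (-s)) (volume.restrict (Ioi 0)) := by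
      simpa [IntegrableOn] using exp_neg_integrableOn_Ioi 0 one_pos
    have h2 : Integrable (fun w : ℝ => C * (w ^ 0 * Real.exp (2 * w) * passageKernel t w))
      (volume.restrict (Ioi 0)) := (integrableOn_pow_mul_exp_mul_passageKernel ht 2 0).const_mul C
    refine (h1.mul_prod h2).mono' (hcont.aestronglyMeasurable.indicator hmeas) ?_
    rw [Measure.prod_restrict, ae_restrict_iff' (measurableSet_Ioi.prod measurableSet_Ioi)]
    refine Filter.Eventually.of_forall fun x hx => ?_
    obtain ⟨hs, hw⟩ : 0 < x.1 ∧ 0 < x.2 := hx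
    have hKn := passageKernel_nonneg (t := t) hw.le
    have hC : 0 ≤ C := nonneg_of_mul_nonneg_left ((abs_nonneg _).trans (hpC _ hs)) (Real.exp_pos _)
    by_cases hlt : x.1 < x.2
    · rw [hf, Set.indicator_of_mem (by exact hlt), norm_mul, norm_mul, Real.norm_of_nonneg hKn,
        Real.norm_of_nonneg (Real.exp_pos _).le, Real.norm_eq_abs]
      calc _ ≤ C * Real.exp x.1 * Real.exp 0 * passageKernel t x.2 := by
            gcongr
            · exact hpC _ hs
            · nlinarith
        _ ≤ C * Real.exp (-x.1 + 2 * x.2) * passageKernel t x.2 := by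
            rw [Real.exp_zero, mul_one]
            gcongr
            linarith
        _ = _ := by rw [Real.exp_add]; ring
    · rw [hf, Set.indicator_of_notMem (by exact hlt), norm_zero]
      positivity
  have hright : ∀ w ∈ Ioi (0 : ℝ), ∫ s in Ioi (0 : ℝ), f (s, w) =
      (∫ s in (0 : ℝ)..w, p s * Real.exp (-α * (w - s))) * passageKernel t w := by
    intro w hw
    have hw : 0 < w := hw
    have e : (fun s => f (s, w)) = (Iio w).indicator
        (fun s => p s * Real.exp (-α * (w - s)) * passageKernel t w) := by
      ext s; simp [hf, Set.indicator_apply]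
    rw [e, setIntegral_indicator measurableSet_Iio, Ioi_inter_Iio, ← integral_Ioc_eq_integral_Ioo,
      ← intervalIntegral.integral_of_le hw.le, intervalIntegral.integral_mul_const]
  have hleft : ∀ s ∈ Ioi (0 : ℝ), p s * Real.exp (α * s) *
        (∫ w in Ioi s, w * Real.exp (-α * w) * Real.exp (-(w ^ 2) / (2 * t)) /
          Real.sqrt (2 * Real.pi * t ^ 3)) = ∫ w in Ioi (0 : ℝ), f (s, w) := by
    intro s hs
    have hs : 0 < s := hs
    have e : (fun w => f (s, w)) = (Ioi s).indicator
        (fun w => p s * Real.exp (-α * (w - s)) * passageKernel t w) := by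
      ext w; simp [hf, Set.indicator_apply]
    rw [e, setIntegral_indicator measurableSet_Ioi, Ioi_inter_Ioi, max_eq_right hs.le,
      ← integral_const_mul]
    refine setIntegral_congr_fun measurableSet_Ioi fun w _ => ?_
    simp only [passageKernel]
    rw [show -α * (w - s) = α * s + -α * w by ring, Real.exp_add]
    ring
  refine ⟨hint.integral_prod_right.congr
    ((ae_restrict_iff' measurableSet_Ioi).2 (Filter.Eventually.of_forall hright)), ?_⟩
  rw [setIntegral_congr_fun measurableSet_Ioi hleft,
    integral_integral_swap (f := fun s w => f (s, w)) hint]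
  exact setIntegral_congr_fun measurableSet_Ioi hright

lemma integral_exp_conv_mul_passageKernel {α t : ℝ} (hα : 0 < α) (ht : 0 < t) :
    ∫ w in Ioi (0 : ℝ), (∫ s in (0 : ℝ)..w, 1 * Real.exp (-α * (w - s))) * passageKernel t w =
      Real.exp (α ^ 2 * t / 2) *
        ∫ u in Ioi (α * Real.sqrt t), Real.exp (-(u ^ 2) / 2) / Real.sqrt (2 * Real.pi) := by
  have hst : 0 < Real.sqrt t := Real.sqrt_pos.2 ht
  have hsq : Real.sqrt t ^ 2 = t := Real.sq_sqrt ht.le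
  have hM : Real.sqrt (2 * Real.pi * t ^ 3) = Real.sqrt (2 * Real.pi) * (Real.sqrt t * t) := by
    rw [Real.sqrt_mul (by positivity), show t ^ 3 = t * t ^ 2 by ring, Real.sqrt_mul ht.le,
      Real.sqrt_sq ht.le]
  have hinner : ∀ w : ℝ, ∫ s in (0 : ℝ)..w, 1 * Real.exp (-α * (w - s)) =
      (1 - Real.exp (-α * w)) / α := by
    intro w
    have := intervalIntegral.integral_eq_sub_of_hasDerivAt (a := 0) (b := w)
      (f := fun s => Real.exp (-α * (w - s)) / α) (f' := fun s => 1 * Real.exp (-α * (w - s)))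
      (fun s _ => by
        have := ((((hasDerivAt_id s).const_sub w).const_mul (-α)).exp).div_const α
        refine this.congr_deriv ?_
        simp only [id]
        field_simp)
      (by apply Continuous.intervalIntegrable; fun_prop)
    rw [this]
    simp
    ring
  simp only [hinner]
  set M := Real.sqrt (2 * Real.pi * t ^ 3) with hMdef
  have hM0 : 0 < M := by positivity
  set g : ℝ → ℝ := fun w => Real.exp (-(w ^ 2) / (2 * t)) with hg
  have hgd : ∀ w, HasDerivAt g (-(w / t) * g w) w := fun w => by
    have := (((hasDerivAt_pow 2 w).neg).div_const (2 * t)).exp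
    refine this.congr_deriv ?_
    simp only [hg, Pi.neg_apply]
    push_cast
    field_simp
  have hI1 : IntegrableOn (fun w => (1 - Real.exp (-α * w)) / α * passageKernel t w) (Ioi 0) := by
    have h := ((integrableOn_pow_mul_exp_mul_passageKernel ht 0 0).sub
      (integrableOn_pow_mul_exp_mul_passageKernel ht (-α) 0)).div_const α
    refine h.congr (Filter.Eventually.of_forall fun w => ?_)
    simp
    ring
  have hI2 : IntegrableOn (fun w => Real.exp (-α * w) * (t / M) * g w) (Ioi 0) := by
    have h := (integrableOn_pow_mul_exp_mul_gaussian ht (-α) 0).mul_const (t / M)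
    refine h.congr (Filter.Eventually.of_forall fun w => ?_)
    simp only [hg]
    ring
  have hparts := integral_Ioi_of_hasDerivAt_of_tendsto
    (f := fun w => -((1 - Real.exp (-α * w)) / α * (t / M) * g w)) (a := 0) (m := 0)
    (f' := fun w => (1 - Real.exp (-α * w)) / α * passageKernel t w -
      Real.exp (-α * w) * (t / M) * g w)
    (by apply Continuous.continuousWithinAt; simp only [hg]; fun_prop)
    (fun w _ => by
      have h1 := (((((hasDerivAt_id w).const_mul (-α)).exp.const_sub 1).div_const α).mul_const
        (t / M)).mul (hgd w)
      refine h1.neg.congr_deriv ?_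
      simp only [id, passageKernel, hg, ← hMdef]
      field_simp
      ring)
    (hI1.sub hI2)
    (by
      have hg0 : Filter.Tendsto g Filter.atTop (nhds 0) := by
        refine Real.tendsto_exp_atBot.comp ?_
        have := (Filter.tendsto_pow_atTop (α := ℝ) two_ne_zero).atTop_div_const
          (show 0 < 2 * t by positivity)
        refine (Filter.tendsto_neg_atTop_atBot.comp this).congr fun w => ?_
        simp [neg_div]
      have he0 : Filter.Tendsto (fun w => Real.exp (-α * w)) Filter.atTop (nhds 0) :=
        Real.tendsto_exp_atBot.comp
          (Filter.tendsto_id.const_mul_atTop_of_neg (neg_lt_zero.2 hα))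
      have := ((((he0.const_sub 1).div_const α).mul_const (t / M)).mul hg0).neg
      simpa using this)
  rw [integral_sub hI1 hI2] at hparts
  have hsub := integral_comp_mul_deriv_Ioi (a := 0)
    (f := fun w => w / Real.sqrt t + α * Real.sqrt t) (f' := fun _ => 1 / Real.sqrt t)
    (g := fun u => Real.exp (-(u ^ 2) / 2) / Real.sqrt (2 * Real.pi))
    (by fun_prop)
    (Filter.tendsto_atTop_add_const_right _ _ (Filter.tendsto_id.atTop_div_const hst))
    (fun w _ => (((hasDerivAt_id w).div_const _).add_const _).hasDerivWithinAt)
    (by fun_prop)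
    (by
      have := (integrable_exp_neg_mul_sq (b := 1 / 2) (by norm_num)).div_const
        (Real.sqrt (2 * Real.pi))
      refine (this.congr (Filter.Eventually.of_forall fun u => ?_)).integrableOn
      simp only
      congr 2
      ring)
  have key : ∀ w : ℝ, Real.exp (-α * w) * (t / M) * g w = Real.exp (α ^ 2 * t / 2) *
      (Real.exp (-((w / Real.sqrt t + α * Real.sqrt t) ^ 2) / 2) / Real.sqrt (2 * Real.pi) *
        (1 / Real.sqrt t)) := by
    intro w
    have e : Real.exp (α ^ 2 * t / 2) *
        Real.exp (-((w / Real.sqrt t + α * Real.sqrt t) ^ 2) / 2) =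
        Real.exp (-α * w) * g w := by
      rw [hg, ← Real.exp_add, ← Real.exp_add]
      congr 1
      rw [add_sq, mul_pow, div_pow, hsq]
      field_simp
      ring
    calc _ = (Real.exp (-α * w) * g w) * (t / M) := by ring
      _ = _ := by
        rw [← e, hM]
        field_simp
  have hsub' := hsub (by
      rw [integrableOn_Ici_iff_integrableOn_Ioi]
      refine (hI2.const_mul (Real.exp (α ^ 2 * t / 2))⁻¹).congr
        (Filter.Eventually.of_forall fun w => ?_)
      simp only [Function.comp, key]
      field_simp)
  simp only [Function.comp, zero_div, zero_add] at hsub'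
  rw [← hsub', ← integral_const_mul]
  simp only [← key]
  simp at hparts
  simp only [neg_mul] at *
  linarith

lemma abs_gammaCdf_le {lam : ℝ} (hlam : 0 < lam) (m : ℕ) {s : ℝ} (hs : 0 < s) :
    |gammaCdf lam (m + 1) s| ≤ lam ^ (m + 1) * Real.exp s := by
  have hΓ : Real.Gamma ((m + 1 : ℕ) : ℝ) = m.factorial := by
    push_cast; exact Real.Gamma_nat_eq_factorial m
  have h0 : 0 ≤ ∫ z in (0 : ℝ)..s, Real.exp (-lam * z) * z ^ m :=
    intervalIntegral.integral_nonneg hs.le fun z hz => by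
      have := hz.1
      positivity
  have h1 : ∫ z in (0 : ℝ)..s, Real.exp (-lam * z) * z ^ m ≤
      ∫ z in (0 : ℝ)..s, m.factorial * Real.exp z := by
    refine intervalIntegral.integral_mono_on hs.le
      (by apply Continuous.intervalIntegrable; fun_prop)
      (by apply Continuous.intervalIntegrable; fun_prop) fun z hz => ?_
    have hz0 := hz.1
    have h2 := Real.pow_div_factorial_le_exp z hz0 m
    rw [div_le_iff₀' (by positivity)] at h2
    have h3 : Real.exp (-lam * z) ≤ 1 := Real.exp_le_one_iff.2 (by nlinarith)
    calc _ ≤ 1 * z ^ m := by gcongr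
      _ ≤ _ := by rwa [one_mul]
  rw [intervalIntegral.integral_const_mul, integral_exp, Real.exp_zero] at h1
  rw [gammaCdf, Nat.add_sub_cancel, hΓ, abs_of_nonneg (by positivity), div_mul_eq_mul_div,
    div_le_iff₀ (by positivity), mul_assoc]
  gcongr
  have : (0 : ℝ) < m.factorial := by positivity
  nlinarith

lemma continuous_gammaCdf (lam : ℝ) (m : ℕ) : Continuous (gammaCdf lam (m + 1)) := by
  unfold gammaCdf
  refine continuous_const.mul (intervalIntegral.continuous_primitive (fun a b => ?_) 0)
  apply Continuous.intervalIntegrable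
  fun_prop

lemma hasSum_integral_gammaCdf_conv_exp {α lam t : ℝ} (hα : 0 < α) (hlam : 0 < lam) (ht : 0 < t)
    (m : ℕ) :
    HasSum (fun n : ℕ × ℕ => convCoeff m α lam n *
      (1 / (2 * Real.Gamma (((m + n.2 + n.1 + 1 : ℕ) : ℝ) / 2 + 1)) *
        (Real.sqrt t / Real.sqrt 2) ^ (m + n.2 + n.1 + 1)))
      (∫ w in Ioi (0 : ℝ), (∫ s in (0 : ℝ)..w, gammaCdf lam (m + 1) s *
        Real.exp (-α * (w - s))) * passageKernel t w) := by
  have hK := continuous_passageKernel t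
  have hsum : ∀ w : ℝ, HasSum (fun n : ℕ × ℕ => lam ^ (m + 1) * w ^ (m + 2) *
        ((α * w) ^ n.1 / n.1.factorial * ((lam * w) ^ n.2 / n.2.factorial)) * passageKernel t w)
      (lam ^ (m + 1) * w ^ (m + 2) * (Real.exp (α * w) * Real.exp (lam * w)) *
        passageKernel t w) := fun w =>
    ((hasSum_mul_real (hasSum_exp_real (α * w)) (hasSum_exp_real (lam * w))).mul_left _).mul_right _
  have h : HasSum (fun n : ℕ × ℕ => ∫ w in Ioi (0 : ℝ), convCoeff m α lam n *
      (w ^ (m + n.2 + n.1 + 2) / (m + n.2 + n.1 + 2).factorial) * passageKernel t w)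
      (∫ w in Ioi (0 : ℝ), (∫ s in (0 : ℝ)..w, gammaCdf lam (m + 1) s *
        Real.exp (-α * (w - s))) * passageKernel t w) := by
    refine hasSum_integral_of_dominated_convergence
      (fun (n : ℕ × ℕ) w => lam ^ (m + 1) * w ^ (m + 2) *
        ((α * w) ^ n.1 / n.1.factorial * ((lam * w) ^ n.2 / n.2.factorial)) * passageKernel t w)
      (fun n => by fun_prop) (fun n => ?_) ?_ ?_ ?_
    · refine (ae_restrict_iff' measurableSet_Ioi).2 (Filter.Eventually.of_forall fun w hw => ?_)
      have hw : 0 < w := hw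
      have hKn := passageKernel_nonneg (t := t) hw.le
      have hP : (∏ i ∈ Finset.range n.2, (((m + 1 : ℕ) : ℝ) + i)) * n.1.factorial ≤
          (m + n.2 + n.1 + 2).factorial :=
        (prod_range_add_natCast_mul_factorial_le m n.2 n.1).trans
          (by exact_mod_cast Nat.factorial_le (by omega))
      have hP0 : 0 ≤ ∏ i ∈ Finset.range n.2, (((m + 1 : ℕ) : ℝ) + i) := by positivity
      rw [convCoeff]
      set P := ∏ i ∈ Finset.range n.2, (((m + 1 : ℕ) : ℝ) + i)
      simp only [norm_mul, norm_div, norm_pow, norm_neg, Real.norm_of_nonneg hlam.le,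
          Real.norm_of_nonneg hw.le, Real.norm_of_nonneg hα.le, Real.norm_of_nonneg hKn,
          Real.norm_of_nonneg hP0, RCLike.norm_natCast]
      refine mul_le_mul_of_nonneg_right ?_ hKn
      have hq : P / (m + n.2 + n.1 + 2).factorial ≤ 1 / n.1.factorial := by
        rw [div_le_div_iff₀ (by positivity) (by positivity), one_mul]
        exact hP
      calc _ = lam ^ (m + 1) * (lam ^ n.2 / n.2.factorial) * α ^ n.1 * w ^ (m + n.2 + n.1 + 2) *
            (P / (m + n.2 + n.1 + 2).factorial) := by ring
        _ ≤ lam ^ (m + 1) * (lam ^ n.2 / n.2.factorial) * α ^ n.1 * w ^ (m + n.2 + n.1 + 2) *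
            (1 / n.1.factorial) := by gcongr
        _ = _ := by ring
    · exact Filter.Eventually.of_forall fun w => (hsum w).summable
    · simp only [fun w => (hsum w).tsum_eq]
      refine ((integrableOn_pow_mul_exp_mul_passageKernel ht (α + lam) (m + 2)).const_mul
        (lam ^ (m + 1))).congr (Filter.Eventually.of_forall fun w => ?_)
      simp only [add_mul, Real.exp_add]
      ring
    · refine (ae_restrict_iff' measurableSet_Ioi).2 (Filter.Eventually.of_forall fun w hw => ?_)
      exact (hasSum_gammaCdf_conv_exp hα hlam m (le_of_lt hw)).mul_right _
  refine (congrArg (HasSum · _) (funext fun n => ?_)).mpr h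
  have hm := integral_pow_mul_passageKernel ht (m + n.2 + n.1 + 1)
  have e : (fun w : ℝ => convCoeff m α lam n *
      (w ^ (m + n.2 + n.1 + 2) / (m + n.2 + n.1 + 2).factorial) * passageKernel t w) =
      fun w => convCoeff m α lam n / (m + n.2 + n.1 + 2).factorial *
        (w ^ (m + n.2 + n.1 + 1 + 1) * passageKernel t w) := by
    ext w; ring
  rw [e, integral_const_mul, hm]
  have : ((m + n.2 + n.1 + 2).factorial : ℝ) ≠ 0 := by positivity
  rw [show m + n.2 + n.1 + 1 + 1 = m + n.2 + n.1 + 2 by ring]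
  field_simp

theorem elastic_gamma_crossing (k : ℕ) (hk : 1 ≤ k) (α lam : ℝ)
    (hα : 0 < α) (hlam : 0 < lam) :
    ∀ t > (0:ℝ),
      psiElGamma k α lam t =
        1 - (lam * Real.sqrt t / Real.sqrt 2) ^ k *
          ∑' l : ℕ, (-(α * Real.sqrt t / Real.sqrt 2)) ^ l *
            gml (1/2) (((l:ℝ) + k) / 2 + 1) k (-(lam * Real.sqrt t / Real.sqrt 2)) := by
  intro t ht
  obtain ⟨m, rfl⟩ : ∃ m, k = m + 1 := ⟨k - 1, by omega⟩
  have hF := continuous_gammaCdf lam m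
  have hone : ∀ s > 0, |(1 : ℝ)| ≤ 1 * Real.exp s := fun s hs => by
    rw [abs_one, one_mul]; exact Real.one_le_exp hs.le
  obtain ⟨hI1, -⟩ := integrable_and_integral_swap (p := fun _ => 1) hα ht continuous_const hone
  obtain ⟨hI2, -⟩ := integrable_and_integral_swap hα ht hF
    fun s hs => abs_gammaCdf_le hlam m hs
  obtain ⟨-, hswap⟩ := integrable_and_integral_swap (p := fun s => 1 - gammaCdf lam (m + 1) s)
    (C := 1 + lam ^ (m + 1)) hα ht (by fun_prop) fun s hs => by
      refine (abs_sub _ _).trans ?_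
      rw [add_mul]
      exact add_le_add (hone s hs) (abs_gammaCdf_le hlam m hs)
  have hsplit : ∀ w : ℝ, (∫ s in (0 : ℝ)..w, (1 - gammaCdf lam (m + 1) s) *
      Real.exp (-α * (w - s))) * passageKernel t w =
      (∫ s in (0 : ℝ)..w, 1 * Real.exp (-α * (w - s))) * passageKernel t w -
      (∫ s in (0 : ℝ)..w, gammaCdf lam (m + 1) s * Real.exp (-α * (w - s))) *
        passageKernel t w := by
    intro w
    rw [← sub_mul, ← intervalIntegral.integral_sub
      (by apply Continuous.intervalIntegrable; fun_prop)
      (by apply Continuous.intervalIntegrable; fun_prop)]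
    simp only [sub_mul]
  simp only [hsplit] at hswap
  rw [integral_sub hI1 hI2, integral_exp_conv_mul_passageKernel hα ht] at hswap
  have hsum := (hasSum_integral_gammaCdf_conv_exp hα hlam ht m).mul_left 2
  have hseries : (lam * Real.sqrt t / Real.sqrt 2) ^ (m + 1) *
      ∑' l : ℕ, (-(α * Real.sqrt t / Real.sqrt 2)) ^ l *
        gml (1/2) (((l:ℝ) + (m + 1 : ℕ)) / 2 + 1) (m + 1 : ℕ)
          (-(lam * Real.sqrt t / Real.sqrt 2)) =
      2 * ∫ w in Ioi (0 : ℝ), (∫ s in (0 : ℝ)..w, gammaCdf lam (m + 1) s *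
        Real.exp (-α * (w - s))) * passageKernel t w := by
    rw [← hsum.tsum_eq, hsum.summable.tsum_prod, ← tsum_mul_left]
    refine tsum_congr fun l => ?_
    rw [gml, ← tsum_mul_left, ← tsum_mul_left]
    refine tsum_congr fun j => ?_
    rw [convCoeff, show (1 / 2 : ℝ) * j + (((l : ℝ) + (m + 1 : ℕ)) / 2 + 1) =
      ((m + j + l + 1 : ℕ) : ℝ) / 2 + 1 by push_cast; ring]
    have hx : ∀ x : ℝ, x * Real.sqrt t / Real.sqrt 2 = x * (Real.sqrt t / Real.sqrt 2) :=
      fun x => mul_div_assoc _ _ _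
    rw [hx, hx, ← neg_mul, ← neg_mul]
    have hG : Real.Gamma (((m + j + l + 1 : ℕ) : ℝ) / 2 + 1) ≠ 0 :=
      (Real.Gamma_pos_of_pos (by positivity)).ne'
    generalize Real.sqrt t / Real.sqrt 2 = r
    simp only [mul_pow]
    field_simp
    ring
  rw [hseries, psiElGamma, hswap]
  ring
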